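/- Assume the standing assumptions, λ⁻¹ > L_g, and let {(X^k, Y^k, Z^k)} be generated by LSALM. Then for every k ≥ 0: ‖X^{k+1} − X(Y^k, Z^k)‖_F ≤ ζ · ‖X^k − X^{k+1}‖_F, where ζ := (2(λ⁻¹+L_ρ)/(r−μ_ρ) + 1)·(√(2L_ρ/(λ⁻¹+L_ρ)) + 1). -/

import Mathlib

open Matrix

noncomputable section

/-- Frobenius inner product `⟨A,B⟩ = tr(AᵀB)`. -/
def frobInner {m n : ℕ} (A B : Matrix (Fin m) (Fin n) ℝ) : ℝ := (Aᵀ * B).trace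

/-- Frobenius norm. -/
def frobNorm {m n : ℕ} (A : Matrix (Fin m) (Fin n) ℝ) : ℝ := Real.sqrt (frobInner A A)

/-- Spectral (operator) norm of a matrix. -/
def specNorm {m n : ℕ} (A : Matrix (Fin m) (Fin n) ℝ) : ℝ :=
  ‖LinearMap.toContinuousLinearMap (Matrix.toEuclideanLin A)‖

/-- `G(X) := XᵀX − Iₙ`. -/
def Gm {m n : ℕ} (X : Matrix (Fin m) (Fin n) ℝ) : Matrix (Fin n) (Fin n) ℝ := Xᵀ * X - 1

/-- `gradl` is the (Fréchet) gradient of `ℓ` w.r.t. the Frobenius inner product. -/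
def IsGradientOf {m n : ℕ} (gradl : Matrix (Fin m) (Fin n) ℝ → Matrix (Fin m) (Fin n) ℝ)
    (ℓ : Matrix (Fin m) (Fin n) ℝ → ℝ) : Prop :=
  ∀ X : Matrix (Fin m) (Fin n) ℝ, ∀ c : ℝ, 0 < c → ∃ δ : ℝ, 0 < δ ∧
    ∀ H : Matrix (Fin m) (Fin n) ℝ, frobNorm H ≤ δ →
      |ℓ (X + H) - ℓ X - frobInner (gradl X) H| ≤ c * frobNorm H

/-- Augmented Lagrangian `ℒ_ρ(X,Y) = f(X) + ⟨Y, G(X)⟩ + (ρ/2)‖G(X)‖_F²` with `f = ℓ + g`. -/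
def Lag {m n : ℕ} (ℓ g : Matrix (Fin m) (Fin n) ℝ → ℝ) (ρ : ℝ)
    (X : Matrix (Fin m) (Fin n) ℝ) (Y : Matrix (Fin n) (Fin n) ℝ) : ℝ :=
  ℓ X + g X + frobInner Y (Gm X) + ρ / 2 * frobNorm (Gm X) ^ 2

/-- `F(X,Y,Z) = ℒ_ρ(X,Y) − (ε/2)‖Y‖_F² + (r/2)‖X−Z‖_F²`. -/
def Ffun {m n : ℕ} (ℓ g : Matrix (Fin m) (Fin n) ℝ → ℝ) (ρ r ε : ℝ)
    (X : Matrix (Fin m) (Fin n) ℝ) (Y : Matrix (Fin n) (Fin n) ℝ)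
    (Z : Matrix (Fin m) (Fin n) ℝ) : ℝ :=
  Lag ℓ g ρ X Y - ε / 2 * frobNorm Y ^ 2 + r / 2 * frobNorm (X - Z) ^ 2

/-- Dual function `d(Y,Z) = min_{X ∈ 𝒳} F(X,Y,Z)`. -/
def dfun {m n : ℕ} (𝒳 : Set (Matrix (Fin m) (Fin n) ℝ))
    (ℓ g : Matrix (Fin m) (Fin n) ℝ → ℝ) (ρ r ε : ℝ)
    (Y : Matrix (Fin n) (Fin n) ℝ) (Z : Matrix (Fin m) (Fin n) ℝ) : ℝ :=
  sInf ((fun X => Ffun ℓ g ρ r ε X Y Z) '' 𝒳)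

/-- Proximal function `p(Z) = max_{Y ∈ 𝒴} d(Y,Z)`. -/
def pfun {m n : ℕ} (𝒳 : Set (Matrix (Fin m) (Fin n) ℝ))
    (𝒴 : Set (Matrix (Fin n) (Fin n) ℝ))
    (ℓ g : Matrix (Fin m) (Fin n) ℝ → ℝ) (ρ r ε : ℝ)
    (Z : Matrix (Fin m) (Fin n) ℝ) : ℝ :=
  sSup ((fun Y => dfun 𝒳 ℓ g ρ r ε Y Z) '' 𝒴)

/-- Potential function `Φ(X,Y,Z) = F(X,Y,Z) − 2d(Y,Z) + 2p(Z)`. -/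
def Phi {m n : ℕ} (𝒳 : Set (Matrix (Fin m) (Fin n) ℝ))
    (𝒴 : Set (Matrix (Fin n) (Fin n) ℝ))
    (ℓ g : Matrix (Fin m) (Fin n) ℝ → ℝ) (ρ r ε : ℝ)
    (X : Matrix (Fin m) (Fin n) ℝ) (Y : Matrix (Fin n) (Fin n) ℝ)
    (Z : Matrix (Fin m) (Fin n) ℝ) : ℝ :=
  Ffun ℓ g ρ r ε X Y Z - 2 * dfun 𝒳 ℓ g ρ r ε Y Z + 2 * pfun 𝒳 𝒴 ℓ g ρ r ε Z

/-- Linearized augmented Lagrangian `ℒ_{X̄,λ}(X,Y)`. -/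
def LinLag {m n : ℕ} (ℓ g : Matrix (Fin m) (Fin n) ℝ → ℝ)
    (gradl : Matrix (Fin m) (Fin n) ℝ → Matrix (Fin m) (Fin n) ℝ) (ρ lam : ℝ)
    (Xb X : Matrix (Fin m) (Fin n) ℝ) (Y : Matrix (Fin n) (Fin n) ℝ) : ℝ :=
  ℓ Xb + frobInner Y (Gm Xb) + ρ / 2 * frobNorm (Gm Xb) ^ 2 + g X
    + frobInner (gradl Xb) (X - Xb)
    + frobInner ((2 : ℝ) • (Xb * (Y + ρ • Gm Xb))) (X - Xb)
    + 1 / (2 * lam) * frobNorm (X - Xb) ^ 2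

/-- The matrix viewed as a vector of the Euclidean space of its entries. -/
def euclideanVec {m n : ℕ} (A : Matrix (Fin m) (Fin n) ℝ) : EuclideanSpace ℝ (Fin m × Fin n) :=
  WithLp.toLp 2 fun p => A p.1 p.2

lemma frobInner_eq_sum {m n : ℕ} (A B : Matrix (Fin m) (Fin n) ℝ) :
    frobInner A B = ∑ i, ∑ j, A i j * B i j := by
  rw [Finset.sum_comm]
  simp [frobInner, Matrix.trace, Matrix.mul_apply]

lemma frobInner_eq_inner {m n : ℕ} (A B : Matrix (Fin m) (Fin n) ℝ) :
    frobInner A B = inner ℝ (euclideanVec A) (euclideanVec B) := by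
  rw [frobInner_eq_sum, ← Fintype.sum_prod_type']
  simp [euclideanVec, PiLp.inner_apply, mul_comm]

lemma frobNorm_eq_norm {m n : ℕ} (A : Matrix (Fin m) (Fin n) ℝ) :
    frobNorm A = ‖euclideanVec A‖ := by
  rw [frobNorm, frobInner_eq_inner, real_inner_self_eq_norm_sq, Real.sqrt_sq (norm_nonneg _)]

lemma frobNorm_nonneg {m n : ℕ} (A : Matrix (Fin m) (Fin n) ℝ) : 0 ≤ frobNorm A :=
  Real.sqrt_nonneg _

lemma frobNorm_sq {m n : ℕ} (A : Matrix (Fin m) (Fin n) ℝ) :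
    frobNorm A ^ 2 = frobInner A A := by
  rw [frobNorm_eq_norm, frobInner_eq_inner, real_inner_self_eq_norm_sq]

lemma frobInner_self_nonneg {m n : ℕ} (A : Matrix (Fin m) (Fin n) ℝ) : 0 ≤ frobInner A A := by
  rw [← frobNorm_sq]; positivity

lemma abs_frobInner_le {m n : ℕ} (A B : Matrix (Fin m) (Fin n) ℝ) :
    |frobInner A B| ≤ frobNorm A * frobNorm B := by
  rw [frobInner_eq_inner, frobNorm_eq_norm, frobNorm_eq_norm]
  exact abs_real_inner_le_norm _ _

lemma frobNorm_add_le {m n : ℕ} (A B : Matrix (Fin m) (Fin n) ℝ) :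
    frobNorm (A + B) ≤ frobNorm A + frobNorm B := by
  simp only [frobNorm_eq_norm]
  exact norm_add_le (euclideanVec A) (euclideanVec B)

lemma frobNorm_smul {m n : ℕ} (c : ℝ) (A : Matrix (Fin m) (Fin n) ℝ) :
    frobNorm (c • A) = |c| * frobNorm A := by
  simp only [frobNorm_eq_norm]
  exact norm_smul c (euclideanVec A)

lemma frobNorm_neg {m n : ℕ} (A : Matrix (Fin m) (Fin n) ℝ) : frobNorm (-A) = frobNorm A := by
  simpa using frobNorm_smul (-1) A

lemma frobInner_add_left {m n : ℕ} (A B C : Matrix (Fin m) (Fin n) ℝ) :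
    frobInner (A + B) C = frobInner A C + frobInner B C := by
  simp [frobInner, Matrix.add_mul]

lemma frobInner_add_right {m n : ℕ} (A B C : Matrix (Fin m) (Fin n) ℝ) :
    frobInner A (B + C) = frobInner A B + frobInner A C := by
  simp [frobInner, Matrix.mul_add]

lemma frobInner_sub_left {m n : ℕ} (A B C : Matrix (Fin m) (Fin n) ℝ) :
    frobInner (A - B) C = frobInner A C - frobInner B C := by
  simp [frobInner, Matrix.sub_mul]

lemma frobInner_sub_right {m n : ℕ} (A B C : Matrix (Fin m) (Fin n) ℝ) :
    frobInner A (B - C) = frobInner A B - frobInner A C := by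
  simp [frobInner, Matrix.mul_sub]

lemma frobInner_smul_left {m n : ℕ} (c : ℝ) (A B : Matrix (Fin m) (Fin n) ℝ) :
    frobInner (c • A) B = c * frobInner A B := by
  simp [frobInner]

lemma frobInner_smul_right {m n : ℕ} (c : ℝ) (A B : Matrix (Fin m) (Fin n) ℝ) :
    frobInner A (c • B) = c * frobInner A B := by
  simp [frobInner]

lemma frobInner_comm {m n : ℕ} (A B : Matrix (Fin m) (Fin n) ℝ) :
    frobInner A B = frobInner B A := by
  simp only [frobInner_eq_inner, real_inner_comm]

lemma frobInner_neg_right {m n : ℕ} (A B : Matrix (Fin m) (Fin n) ℝ) :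
    frobInner A (-B) = -frobInner A B := by
  simp [frobInner]

lemma frobInner_transpose {m n : ℕ} (A B : Matrix (Fin m) (Fin n) ℝ) :
    frobInner Aᵀ Bᵀ = frobInner A B := by
  simp only [frobInner_eq_sum, Matrix.transpose_apply]
  rw [Finset.sum_comm]

lemma frobNorm_transpose {m n : ℕ} (A : Matrix (Fin m) (Fin n) ℝ) :
    frobNorm Aᵀ = frobNorm A := by
  rw [frobNorm, frobInner_transpose, frobNorm]

lemma frobInner_mul_left {m n p : ℕ} (A : Matrix (Fin m) (Fin p) ℝ)
    (B : Matrix (Fin p) (Fin n) ℝ) (C : Matrix (Fin m) (Fin n) ℝ) :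
    frobInner (A * B) C = frobInner B (Aᵀ * C) := by
  simp [frobInner, Matrix.mul_assoc]

lemma frobInner_mul_right {m n p : ℕ} (A : Matrix (Fin m) (Fin p) ℝ)
    (B : Matrix (Fin p) (Fin n) ℝ) (C : Matrix (Fin m) (Fin n) ℝ) :
    frobInner (A * B) C = frobInner A (C * Bᵀ) := by
  rw [← frobInner_transpose, Matrix.transpose_mul, frobInner_mul_left, ← frobInner_transpose]
  simp

lemma specNorm_nonneg {m n : ℕ} (A : Matrix (Fin m) (Fin n) ℝ) : 0 ≤ specNorm A :=
  norm_nonneg _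

open scoped Matrix.Norms.L2Operator in
lemma specNorm_eq_l2_opNorm {m n : ℕ} (A : Matrix (Fin m) (Fin n) ℝ) : specNorm A = ‖A‖ := rfl

open scoped Matrix.Norms.L2Operator in
lemma specNorm_transpose {m n : ℕ} (A : Matrix (Fin m) (Fin n) ℝ) :
    specNorm Aᵀ = specNorm A := by
  rw [specNorm_eq_l2_opNorm, specNorm_eq_l2_opNorm, ← Matrix.l2_opNorm_conjTranspose A,
    Matrix.conjTranspose_eq_transpose_of_trivial]

open scoped Matrix.Norms.L2Operator in
lemma frobNorm_mul_le_specNorm_mul {m n p : ℕ} (A : Matrix (Fin m) (Fin p) ℝ)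
    (B : Matrix (Fin p) (Fin n) ℝ) : frobNorm (A * B) ≤ specNorm A * frobNorm B := by
  have hcol : ∀ j, ∑ i, (A * B) i j ^ 2 ≤ specNorm A ^ 2 * ∑ i, B i j ^ 2 := by
    intro j
    have h := Matrix.l2_opNorm_mulVec A (WithLp.toLp 2 fun i => B i j)
    have h2 := pow_le_pow_left₀ (norm_nonneg _) h 2
    rw [mul_pow, EuclideanSpace.norm_sq_eq, EuclideanSpace.norm_sq_eq] at h2
    simpa [Matrix.mulVec, dotProduct, Matrix.mul_apply, specNorm_eq_l2_opNorm] using h2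
  refine le_of_sq_le_sq ?_ (mul_nonneg (specNorm_nonneg _) (frobNorm_nonneg _))
  rw [mul_pow, frobNorm_sq, frobNorm_sq, frobInner_eq_sum, frobInner_eq_sum, Finset.sum_comm,
    Finset.sum_comm (f := fun i j => B i j * B i j), Finset.mul_sum]
  refine Finset.sum_le_sum fun j _ => ?_
  simpa only [pow_two] using hcol j

lemma frobNorm_mul_le_mul_specNorm {m n p : ℕ} (A : Matrix (Fin m) (Fin p) ℝ)
    (B : Matrix (Fin p) (Fin n) ℝ) : frobNorm (A * B) ≤ frobNorm A * specNorm B := by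
  rw [← frobNorm_transpose, Matrix.transpose_mul, mul_comm, ← frobNorm_transpose A,
    ← specNorm_transpose B]
  exact frobNorm_mul_le_specNorm_mul _ _

attribute [local instance] Matrix.frobeniusNormedAddCommGroup in
lemma frobNorm_mul_le {m n p : ℕ} (A : Matrix (Fin m) (Fin p) ℝ)
    (B : Matrix (Fin p) (Fin n) ℝ) : frobNorm (A * B) ≤ frobNorm A * frobNorm B := by
  have key : ∀ {a b : ℕ} (M : Matrix (Fin a) (Fin b) ℝ), frobNorm M = ‖M‖ := by
    intro a b M
    rw [Matrix.frobenius_norm_def, frobNorm, frobInner_eq_sum, Real.sqrt_eq_rpow]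
    simp [pow_two]
  rw [key, key, key]
  exact Matrix.frobenius_norm_mul A B

lemma frobInner_cubic_sub_nonneg {m n : ℕ} (A B : Matrix (Fin m) (Fin n) ℝ) :
    0 ≤ frobInner (A * (Aᵀ * A) - B * (Bᵀ * B)) (A - B) := by
  have hP := frobInner_self_nonneg (Aᵀ * A - Bᵀ * B)
  have hA := frobInner_self_nonneg ((A - B) * Aᵀ)
  have hB := frobInner_self_nonneg ((A - B) * Bᵀ)
  have hid : 2 * frobInner (A * (Aᵀ * A) - B * (Bᵀ * B)) (A - B)
      = frobInner (Aᵀ * A - Bᵀ * B) (Aᵀ * A - Bᵀ * B)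
        + frobInner ((A - B) * Aᵀ) ((A - B) * Aᵀ)
        + frobInner ((A - B) * Bᵀ) ((A - B) * Bᵀ) := by
    have hgram : ∀ M : Matrix (Fin m) (Fin n) ℝ, frobInner ((A - B) * Mᵀ) ((A - B) * Mᵀ)
        = frobInner (Mᵀ * M) ((A - B)ᵀ * (A - B)) := by
      intro M
      rw [frobInner_mul_left, frobInner_comm, ← Matrix.mul_assoc, frobInner_mul_right,
        Matrix.transpose_transpose, frobInner_comm]
    have hsymm : ∀ M : Matrix (Fin m) (Fin n) ℝ,
        frobInner (Mᵀ * M) (Bᵀ * A) = frobInner (Mᵀ * M) (Aᵀ * B) := by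
      intro M
      rw [← frobInner_transpose]
      simp
    rw [hgram, hgram]
    simp only [Matrix.transpose_sub, Matrix.sub_mul, Matrix.mul_sub, frobInner_sub_left,
      frobInner_sub_right, frobInner_mul_left A (Aᵀ * A), frobInner_mul_left B (Bᵀ * B), hsymm,
      frobInner_comm (Bᵀ * B) (Aᵀ * A)]
    ring
  linarith

lemma frobNorm_cubic_sub_le {m n : ℕ} {A B : Matrix (Fin m) (Fin n) ℝ} {R : ℝ}
    (hA : specNorm A ≤ R) (hB : specNorm B ≤ R) :
    frobNorm (A * (Aᵀ * A) - B * (Bᵀ * B)) ≤ 3 * R ^ 2 * frobNorm (A - B) := by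
  have hsplit : A * (Aᵀ * A) - B * (Bᵀ * B)
      = (A - B) * Aᵀ * A + B * (A - B)ᵀ * A + B * (Bᵀ * (A - B)) := by
    simp only [Matrix.transpose_sub, Matrix.sub_mul, Matrix.mul_sub, Matrix.mul_assoc]
    abel
  have hR : 0 ≤ R := (specNorm_nonneg A).trans hA
  have hd := frobNorm_nonneg (A - B)
  have hA' : specNorm Aᵀ ≤ R := (specNorm_transpose A).trans_le hA
  have hB' : specNorm Bᵀ ≤ R := (specNorm_transpose B).trans_le hB
  have h1 : frobNorm ((A - B) * Aᵀ * A) ≤ frobNorm (A - B) * R * R :=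
    (frobNorm_mul_le_mul_specNorm _ _).trans (mul_le_mul
      ((frobNorm_mul_le_mul_specNorm _ _).trans (mul_le_mul_of_nonneg_left hA' hd)) hA
      (specNorm_nonneg _) (mul_nonneg hd hR))
  have h2 : frobNorm (B * (A - B)ᵀ * A) ≤ R * frobNorm (A - B) * R :=
    (frobNorm_mul_le_mul_specNorm _ _).trans (mul_le_mul
      ((frobNorm_mul_le_specNorm_mul _ _).trans
        (mul_le_mul hB (frobNorm_transpose _).le (frobNorm_nonneg _) hR)) hA
      (specNorm_nonneg _) (mul_nonneg hR hd))
  have h3 : frobNorm (B * (Bᵀ * (A - B))) ≤ R * (R * frobNorm (A - B)) :=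
    (frobNorm_mul_le_specNorm_mul _ _).trans (mul_le_mul hB
      ((frobNorm_mul_le_specNorm_mul _ _).trans (mul_le_mul_of_nonneg_right hB' hd))
      (frobNorm_nonneg _) hR)
  rw [hsplit]
  have h4 := frobNorm_add_le ((A - B) * Aᵀ * A + B * (A - B)ᵀ * A) (B * (Bᵀ * (A - B)))
  have h5 := frobNorm_add_le ((A - B) * Aᵀ * A) (B * (A - B)ᵀ * A)
  linarith

lemma IsGradientOf.hasDerivAt_line {m n : ℕ}
    {gradl : Matrix (Fin m) (Fin n) ℝ → Matrix (Fin m) (Fin n) ℝ}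
    {ℓ : Matrix (Fin m) (Fin n) ℝ → ℝ} (h : IsGradientOf gradl ℓ)
    (W D : Matrix (Fin m) (Fin n) ℝ) :
    HasDerivAt (fun t : ℝ => ℓ (W + t • D)) (frobInner (gradl W) D) 0 := by
  rw [hasDerivAt_iff_isLittleO, Asymptotics.isLittleO_iff]
  intro c hc
  have hd := frobNorm_nonneg D
  obtain ⟨δ, hδ, hb⟩ := h W (c / (frobNorm D + 1)) (by positivity)
  filter_upwards [Metric.ball_mem_nhds (0 : ℝ) (show 0 < δ / (frobNorm D + 1) by positivity)]
    with t ht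
  rw [mem_ball_zero_iff, Real.norm_eq_abs, lt_div_iff₀ (by positivity)] at ht
  have hn : frobNorm (t • D) ≤ δ := by
    rw [frobNorm_smul]
    nlinarith [abs_nonneg t]
  have hb' := hb _ hn
  rw [frobInner_smul_right, frobNorm_smul] at hb'
  simp only [zero_smul, add_zero, sub_zero, smul_eq_mul, Real.norm_eq_abs]
  refine hb'.trans ?_
  rw [div_mul_eq_mul_div, div_le_iff₀ (by positivity)]
  nlinarith [mul_nonneg hc.le (abs_nonneg t)]

lemma hasDerivAt_quadratic_zero (a b c : ℝ) :
    HasDerivAt (fun t : ℝ => a + t * b + t ^ 2 * c) b 0 := by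
  have h := (((hasDerivAt_id (0 : ℝ)).mul_const b).const_add a).fun_add
    (((hasDerivAt_id (0 : ℝ)).fun_pow 2).mul_const c)
  simpa using h

lemma hasDerivAt_frobNorm_sq_line {m n : ℕ} (W D Z : Matrix (Fin m) (Fin n) ℝ) :
    HasDerivAt (fun t : ℝ => frobNorm (W + t • D - Z) ^ 2) (2 * frobInner (W - Z) D) 0 := by
  have heq : (fun t : ℝ => frobNorm (W + t • D - Z) ^ 2) = fun t : ℝ =>
      frobInner (W - Z) (W - Z) + t * (2 * frobInner (W - Z) D) + t ^ 2 * frobInner D D := by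
    funext t
    rw [frobNorm_sq, show W + t • D - Z = (W - Z) + t • D by abel]
    simp only [frobInner_add_left, frobInner_add_right, frobInner_smul_left,
      frobInner_smul_right, frobInner_comm D (W - Z)]
    ring
  rw [heq]
  exact hasDerivAt_quadratic_zero _ _ _

lemma Gm_line {m n : ℕ} (W D : Matrix (Fin m) (Fin n) ℝ) (t : ℝ) :
    Gm (W + t • D) = Gm W + t • (Wᵀ * D + Dᵀ * W) + t ^ 2 • (Dᵀ * D) := by
  simp only [Gm, Matrix.transpose_add, Matrix.transpose_smul, Matrix.add_mul, Matrix.mul_add,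
    Matrix.smul_mul, Matrix.mul_smul, smul_add, smul_smul, pow_two]
  abel

lemma Gm_isSymm {m n : ℕ} (W : Matrix (Fin m) (Fin n) ℝ) : (Gm W).IsSymm := by
  simp [Matrix.IsSymm, Gm]

lemma Matrix.IsSymm.frobInner_symmetrized {m n : ℕ} {Y : Matrix (Fin n) (Fin n) ℝ}
    (hY : Y.IsSymm) (W D : Matrix (Fin m) (Fin n) ℝ) :
    frobInner Y (Wᵀ * D + Dᵀ * W) = 2 * frobInner (W * Y) D := by
  have h : frobInner Y (Dᵀ * W) = frobInner Y (Wᵀ * D) := by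
    rw [← frobInner_transpose, hY.eq]
    simp
  rw [frobInner_add_right, h, frobInner_mul_left]
  ring

lemma hasDerivAt_frobInner_Gm_line {m n : ℕ} {Y : Matrix (Fin n) (Fin n) ℝ} (hY : Y.IsSymm)
    (W D : Matrix (Fin m) (Fin n) ℝ) :
    HasDerivAt (fun t : ℝ => frobInner Y (Gm (W + t • D))) (2 * frobInner (W * Y) D) 0 := by
  simp only [Gm_line, frobInner_add_right, frobInner_smul_right]
  rw [← frobInner_add_right, hY.frobInner_symmetrized]
  exact hasDerivAt_quadratic_zero _ _ _

lemma hasDerivAt_frobNorm_Gm_sq_line {m n : ℕ} (W D : Matrix (Fin m) (Fin n) ℝ) :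
    HasDerivAt (fun t : ℝ => frobNorm (Gm (W + t • D)) ^ 2) (4 * frobInner (W * Gm W) D) 0 := by
  set E := Wᵀ * D + Dᵀ * W with hE
  have heq : (fun t : ℝ => frobNorm (Gm (W + t • D)) ^ 2) = fun t : ℝ =>
      (frobInner (Gm W) (Gm W) + t * (4 * frobInner (W * Gm W) D)
        + t ^ 2 * (frobInner E E + 2 * frobInner (Gm W) (Dᵀ * D)))
      + t ^ 2 * (t * (2 * frobInner E (Dᵀ * D)) + t ^ 2 * frobInner (Dᵀ * D) (Dᵀ * D)) := by
    funext t
    have h1 := (Gm_isSymm W).frobInner_symmetrized W D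
    rw [← hE] at h1
    rw [frobNorm_sq, Gm_line, ← hE]
    simp only [frobInner_add_left, frobInner_add_right, frobInner_smul_left,
      frobInner_smul_right, frobInner_comm E (Gm W), frobInner_comm (Dᵀ * D) (Gm W),
      frobInner_comm (Dᵀ * D) E, h1]
    ring
  rw [heq]
  have h := (hasDerivAt_quadratic_zero (frobInner (Gm W) (Gm W)) (4 * frobInner (W * Gm W) D)
    (frobInner E E + 2 * frobInner (Gm W) (Dᵀ * D))).fun_add
    (((hasDerivAt_id (0 : ℝ)).fun_pow 2).fun_mul
      (hasDerivAt_quadratic_zero 0 (2 * frobInner E (Dᵀ * D)) (frobInner (Dᵀ * D) (Dᵀ * D))))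
  simpa using h

lemma nonneg_of_hasDerivAt_of_le {u : ℝ → ℝ} {u' : ℝ} (hu : HasDerivAt u u' 0)
    (hle : ∀ t, 0 < t → t < 1 → u 0 ≤ u t) : 0 ≤ u' := by
  have h := (hasDerivAt_iff_tendsto_slope.mp hu).mono_left
    (nhdsGT_le_nhdsNE 0)
  refine ge_of_tendsto h ?_
  filter_upwards [Ioo_mem_nhdsGT (zero_lt_one : (0 : ℝ) < 1)] with t ht
  rw [slope_def_field]
  exact div_nonneg (sub_nonneg.mpr (hle t ht.1 ht.2)) (by linarith [ht.1])

/-- First-order optimality of a minimizer of `s + g`, with `s` differentiable along segments and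
`g` weakly convex. -/
lemma first_order_of_isMin_add_weaklyConvex {m n : ℕ} {𝒳 : Set (Matrix (Fin m) (Fin n) ℝ)}
    {s g : Matrix (Fin m) (Fin n) ℝ → ℝ} {Lg s' : ℝ}
    (hg : ConvexOn ℝ 𝒳 (fun X => g X + Lg / 2 * frobNorm X ^ 2))
    {W V : Matrix (Fin m) (Fin n) ℝ} (hW : W ∈ 𝒳) (hV : V ∈ 𝒳)
    (hmin : ∀ X ∈ 𝒳, s W + g W ≤ s X + g X)
    (hs : HasDerivAt (fun t : ℝ => s (W + t • (V - W))) s' 0) :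
    0 ≤ s' + (g V - g W + Lg / 2 * frobNorm (V - W) ^ 2) := by
  set q := frobNorm (V - W) ^ 2 with hq
  refine nonneg_of_hasDerivAt_of_le (u := fun t => s (W + t • (V - W)) +
    (0 + t * (g V - g W + Lg / 2 * q) + t ^ 2 * (-(Lg / 2 * q))))
    (hs.add (hasDerivAt_quadratic_zero _ _ _)) fun t ht0 ht1 => ?_
  have hline : (1 - t) • W + t • V = W + t • (V - W) := by
    rw [sub_smul, one_smul, smul_sub]; abel
  have hconv := hg.2 hW hV (sub_nonneg.mpr ht1.le) ht0.le (by ring)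
  have hmem := hg.1 hW hV (sub_nonneg.mpr ht1.le) ht0.le (by ring)
  rw [hline] at hmem
  have hmin' := hmin _ hmem
  have hsq : frobNorm ((1 - t) • W + t • V) ^ 2
      = (1 - t) * frobNorm W ^ 2 + t * frobNorm V ^ 2 - t * (1 - t) * q := by
    simp only [hq, frobNorm_sq, frobInner_add_left, frobInner_add_right, frobInner_sub_left,
      frobInner_sub_right, frobInner_smul_left, frobInner_smul_right, frobInner_comm V W]
    ring
  simp only [smul_eq_mul, hsq] at hconv
  rw [hline] at hconv
  simp only [zero_smul, add_zero]
  nlinarith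

/-- Gradient of the smooth part `ℓ + ⟨Y, G⟩ + (ρ/2)‖G‖_F²` of the augmented Lagrangian. -/
def smoothGrad {m n : ℕ} (gradl : Matrix (Fin m) (Fin n) ℝ → Matrix (Fin m) (Fin n) ℝ) (ρ : ℝ)
    (Y : Matrix (Fin n) (Fin n) ℝ) (X : Matrix (Fin m) (Fin n) ℝ) : Matrix (Fin m) (Fin n) ℝ :=
  gradl X + (2 : ℝ) • (X * (Y + ρ • Gm X))

lemma smoothGrad_sub {m n : ℕ}
    (gradl : Matrix (Fin m) (Fin n) ℝ → Matrix (Fin m) (Fin n) ℝ) (ρ : ℝ)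
    (Y : Matrix (Fin n) (Fin n) ℝ) (A B : Matrix (Fin m) (Fin n) ℝ) :
    smoothGrad gradl ρ Y A - smoothGrad gradl ρ Y B = (gradl A - gradl B)
      + (2 : ℝ) • ((A - B) * Y) + (2 * ρ) • (A * (Aᵀ * A) - B * (Bᵀ * B))
      + (-(2 * ρ)) • (A - B) := by
  simp only [smoothGrad, Gm, Matrix.mul_add, Matrix.mul_smul, Matrix.mul_sub, Matrix.sub_mul,
    Matrix.mul_one]
  module

lemma frobNorm_smoothGrad_sub_le {m n : ℕ}
    {gradl : Matrix (Fin m) (Fin n) ℝ → Matrix (Fin m) (Fin n) ℝ} {ρ Lℓ RX RY : ℝ}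
    {Y : Matrix (Fin n) (Fin n) ℝ} {A B : Matrix (Fin m) (Fin n) ℝ} (hρ : 0 ≤ ρ)
    (hlip : frobNorm (gradl A - gradl B) ≤ Lℓ * frobNorm (A - B)) (hY : frobNorm Y ≤ RY)
    (hA : specNorm A ≤ RX) (hB : specNorm B ≤ RX) :
    frobNorm (smoothGrad gradl ρ Y A - smoothGrad gradl ρ Y B)
      ≤ (Lℓ + 2 * RY + 6 * ρ * RX ^ 2 + 2 * ρ) * frobNorm (A - B) := by
  rw [smoothGrad_sub]
  set P := gradl A - gradl B
  set C := A * (Aᵀ * A) - B * (Bᵀ * B) with hCdef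
  have h1 := frobNorm_add_le (P + (2 : ℝ) • ((A - B) * Y) + (2 * ρ) • C) ((-(2 * ρ)) • (A - B))
  have h2 := frobNorm_add_le (P + (2 : ℝ) • ((A - B) * Y)) ((2 * ρ) • C)
  have h3 := frobNorm_add_le P ((2 : ℝ) • ((A - B) * Y))
  have h2ρ : |2 * ρ| = 2 * ρ := abs_of_nonneg (by positivity)
  rw [frobNorm_smul, abs_neg, h2ρ] at h1
  rw [frobNorm_smul, h2ρ] at h2
  rw [frobNorm_smul, abs_two] at h3
  have hC : frobNorm C ≤ 3 * RX ^ 2 * frobNorm (A - B) := frobNorm_cubic_sub_le hA hB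
  have hY' := (frobNorm_mul_le (A - B) Y).trans
    (mul_le_mul_of_nonneg_left hY (frobNorm_nonneg (A - B)))
  have hC' := mul_le_mul_of_nonneg_left hC hρ
  linarith

lemma frobInner_smoothGrad_sub_ge {m n : ℕ}
    {gradl : Matrix (Fin m) (Fin n) ℝ → Matrix (Fin m) (Fin n) ℝ} {ρ Lℓ RY : ℝ}
    {Y : Matrix (Fin n) (Fin n) ℝ} {A B : Matrix (Fin m) (Fin n) ℝ} (hρ : 0 ≤ ρ)
    (hlip : frobNorm (gradl A - gradl B) ≤ Lℓ * frobNorm (A - B)) (hY : frobNorm Y ≤ RY) :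
    -((Lℓ + 2 * RY + 2 * ρ) * frobNorm (A - B) ^ 2)
      ≤ frobInner (smoothGrad gradl ρ Y A - smoothGrad gradl ρ Y B) (A - B) := by
  have hd := frobNorm_nonneg (A - B)
  rw [smoothGrad_sub, frobInner_add_left, frobInner_add_left, frobInner_add_left,
    frobInner_smul_left, frobInner_smul_left, frobInner_smul_left, ← frobNorm_sq (A - B)]
  have h1 := neg_le_of_abs_le ((abs_frobInner_le (gradl A - gradl B) (A - B)).trans
    (mul_le_mul_of_nonneg_right hlip hd))
  have h2 := neg_le_of_abs_le ((abs_frobInner_le ((A - B) * Y) (A - B)).trans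
    (mul_le_mul_of_nonneg_right ((frobNorm_mul_le (A - B) Y).trans
      (mul_le_mul_of_nonneg_left hY hd)) hd))
  have h3 := mul_nonneg hρ (frobInner_cubic_sub_nonneg A B)
  linarith

lemma Ffun_minimizer_first_order {m n : ℕ} {𝒳 : Set (Matrix (Fin m) (Fin n) ℝ)}
    {ℓ g : Matrix (Fin m) (Fin n) ℝ → ℝ}
    {gradl : Matrix (Fin m) (Fin n) ℝ → Matrix (Fin m) (Fin n) ℝ} {Lg ρ r ε : ℝ}
    (hgrad : IsGradientOf gradl ℓ)
    (hg : ConvexOn ℝ 𝒳 (fun X => g X + Lg / 2 * frobNorm X ^ 2))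
    {W V Z : Matrix (Fin m) (Fin n) ℝ} {Y : Matrix (Fin n) (Fin n) ℝ} (hY : Y.IsSymm)
    (hW : W ∈ 𝒳) (hV : V ∈ 𝒳)
    (hmin : ∀ X ∈ 𝒳, Ffun ℓ g ρ r ε W Y Z ≤ Ffun ℓ g ρ r ε X Y Z) :
    0 ≤ frobInner (smoothGrad gradl ρ Y W + r • (W - Z)) (V - W)
      + (g V - g W + Lg / 2 * frobNorm (V - W) ^ 2) := by
  have hs := (((hgrad.hasDerivAt_line W (V - W)).add
    (hasDerivAt_frobInner_Gm_line hY W (V - W))).add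
    ((hasDerivAt_frobNorm_Gm_sq_line W (V - W)).const_mul (ρ / 2))).add
    ((hasDerivAt_frobNorm_sq_line W (V - W) Z).const_mul (r / 2))
  have h := first_order_of_isMin_add_weaklyConvex
    (s := fun X => ℓ X + frobInner Y (Gm X) + ρ / 2 * frobNorm (Gm X) ^ 2
      + r / 2 * frobNorm (X - Z) ^ 2) hg hW hV
    (fun X hX => by
      have := hmin X hX
      simp only [Ffun, Lag] at this
      linarith) hs
  convert h using 2
  simp only [smoothGrad, frobInner_add_left, frobInner_smul_left, Matrix.mul_add,
    Matrix.mul_smul]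
  ring

lemma LinLag_minimizer_first_order {m n : ℕ} {𝒳 : Set (Matrix (Fin m) (Fin n) ℝ)}
    {ℓ g : Matrix (Fin m) (Fin n) ℝ → ℝ}
    {gradl : Matrix (Fin m) (Fin n) ℝ → Matrix (Fin m) (Fin n) ℝ} {Lg ρ r lam : ℝ}
    (hg : ConvexOn ℝ 𝒳 (fun X => g X + Lg / 2 * frobNorm X ^ 2))
    {Xb W V Z : Matrix (Fin m) (Fin n) ℝ} {Y : Matrix (Fin n) (Fin n) ℝ}
    (hW : W ∈ 𝒳) (hV : V ∈ 𝒳)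
    (hmin : ∀ X ∈ 𝒳, LinLag ℓ g gradl ρ lam Xb W Y + r / 2 * frobNorm (W - Z) ^ 2
      ≤ LinLag ℓ g gradl ρ lam Xb X Y + r / 2 * frobNorm (X - Z) ^ 2) :
    0 ≤ frobInner (smoothGrad gradl ρ Y Xb + lam⁻¹ • (W - Xb) + r • (W - Z)) (V - W)
      + (g V - g W + Lg / 2 * frobNorm (V - W) ^ 2) := by
  set K := smoothGrad gradl ρ Y Xb with hK
  have hlin : HasDerivAt (fun t : ℝ => frobInner K (W + t • (V - W) - Xb))
      (frobInner K (V - W)) 0 := by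
    have heq : (fun t : ℝ => frobInner K (W + t • (V - W) - Xb)) = fun t : ℝ =>
        frobInner K (W - Xb) + t * frobInner K (V - W) + t ^ 2 * 0 := by
      funext t
      rw [add_sub_right_comm, frobInner_add_right, frobInner_smul_right]
      ring
    rw [heq]
    exact hasDerivAt_quadratic_zero _ _ _
  have hs := (hlin.add ((hasDerivAt_frobNorm_sq_line W (V - W) Xb).const_mul (1 / (2 * lam)))).add
    ((hasDerivAt_frobNorm_sq_line W (V - W) Z).const_mul (r / 2))
  have h := first_order_of_isMin_add_weaklyConvex
    (s := fun X => frobInner K (X - Xb) + 1 / (2 * lam) * frobNorm (X - Xb) ^ 2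
      + r / 2 * frobNorm (X - Z) ^ 2) hg hW hV
    (fun X hX => by
      have := hmin X hX
      simp only [LinLag] at this
      simp only [hK, smoothGrad, frobInner_add_left (gradl Xb)]
      linarith) hs
  convert h using 2
  simp only [frobInner_add_left, frobInner_smul_left, one_div, mul_inv]
  ring

/-- One linearized proximal step `Xp` from `X` and the exact proximal minimizer `W` satisfy
`(r - μ)‖Xp - W‖² ≤ (λ⁻¹ + L)‖X - Xp‖‖Xp - W‖`. -/
lemma linearized_step_error {m n : ℕ} {𝒳 : Set (Matrix (Fin m) (Fin n) ℝ)}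
    {ℓ g : Matrix (Fin m) (Fin n) ℝ → ℝ}
    {gradl : Matrix (Fin m) (Fin n) ℝ → Matrix (Fin m) (Fin n) ℝ}
    {Lℓ Lg ρ RX RY r ε lam : ℝ}
    (h𝒳R : ∀ X ∈ 𝒳, specNorm X ≤ RX) (hgrad : IsGradientOf gradl ℓ)
    (hlip : ∀ X ∈ 𝒳, ∀ X' ∈ 𝒳, frobNorm (gradl X - gradl X') ≤ Lℓ * frobNorm (X - X'))
    (hgwc : ConvexOn ℝ 𝒳 (fun X => g X + Lg / 2 * frobNorm X ^ 2))
    (hρ : 0 ≤ ρ) (hlam : 0 < lam)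
    {X Xp W Z : Matrix (Fin m) (Fin n) ℝ} {Y : Matrix (Fin n) (Fin n) ℝ}
    (hY : Y.IsSymm) (hYR : frobNorm Y ≤ RY) (hX : X ∈ 𝒳) (hXp : Xp ∈ 𝒳) (hW : W ∈ 𝒳)
    (hWmin : ∀ X' ∈ 𝒳, Ffun ℓ g ρ r ε W Y Z ≤ Ffun ℓ g ρ r ε X' Y Z)
    (hXpmin : ∀ X' ∈ 𝒳, LinLag ℓ g gradl ρ lam X Xp Y + r / 2 * frobNorm (Xp - Z) ^ 2
      ≤ LinLag ℓ g gradl ρ lam X X' Y + r / 2 * frobNorm (X' - Z) ^ 2) :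
    (r - ((Lℓ + Lg) + 2 * RY + 2 * ρ)) * frobNorm (Xp - W) ^ 2
      ≤ (lam⁻¹ + (Lℓ + 2 * RY + 6 * ρ * RX ^ 2 + 2 * ρ)) * frobNorm (X - Xp)
        * frobNorm (Xp - W) := by
  have hopt1 := Ffun_minimizer_first_order hgrad hgwc hY hW hXp hWmin
  have hopt2 := LinLag_minimizer_first_order hgwc hXp hW hXpmin
  have hmono := frobInner_smoothGrad_sub_ge hρ (hlip Xp hXp W hW) hYR
  have hsmooth := frobNorm_smoothGrad_sub_le hρ (hlip X hX Xp hXp) hYR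
    (h𝒳R X hX) (h𝒳R Xp hXp)
  set d := frobNorm (Xp - W) with hd
  set e := frobNorm (X - Xp) with he
  have hd0 : 0 ≤ d := frobNorm_nonneg _
  have hneg : W - Xp = -(Xp - W) := (neg_sub _ _).symm
  rw [hneg, frobNorm_neg, frobInner_neg_right, ← hd] at hopt2
  have hcs1 := neg_le_of_abs_le ((abs_frobInner_le (smoothGrad gradl ρ Y X
    - smoothGrad gradl ρ Y Xp) (Xp - W)).trans (mul_le_mul_of_nonneg_right hsmooth hd0))
  have hcs2 := le_of_abs_le (abs_frobInner_le (X - Xp) (Xp - W))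
  have hcs2' := mul_le_mul_of_nonneg_left hcs2 (inv_nonneg.mpr hlam.le)
  have hdd : frobInner (Xp - Z) (Xp - W) - frobInner (W - Z) (Xp - W) = d ^ 2 := by
    rw [← frobInner_sub_left, sub_sub_sub_cancel_right, hd, frobNorm_sq]
  have hXX : frobInner (Xp - X) (Xp - W) = -frobInner (X - Xp) (Xp - W) := by
    simp only [frobInner_sub_left]; ring
  rw [frobInner_sub_left] at hmono hcs1
  simp only [frobInner_add_left, frobInner_smul_left, hXX] at hopt1 hopt2
  linear_combination hopt1 + hopt2 + hmono + hcs1 + hcs2' - r * hdd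

/-- Primal error bound: `‖X^{k+1} − X(Y^k,Z^k)‖_F ≤ ζ‖X^k − X^{k+1}‖_F`. -/
theorem primal_error_bound {m n : ℕ} (hmn : n ≤ m)
    (𝒳 : Set (Matrix (Fin m) (Fin n) ℝ)) (𝒴 : Set (Matrix (Fin n) (Fin n) ℝ))
    (ℓ g : Matrix (Fin m) (Fin n) ℝ → ℝ)
    (gradl : Matrix (Fin m) (Fin n) ℝ → Matrix (Fin m) (Fin n) ℝ)
    (Lℓ Lg ρ RX RY r ε lam α β μρ Lρ ζ : ℝ)
    (h𝒳conv : Convex ℝ 𝒳) (h𝒳cpt : IsCompact 𝒳)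
    (h𝒳R : ∀ X ∈ 𝒳, specNorm X ≤ RX)
    (hgrad : IsGradientOf gradl ℓ) (hgradcont : Continuous gradl)
    (hgradLip : ∀ X ∈ 𝒳, ∀ X' ∈ 𝒳, frobNorm (gradl X - gradl X') ≤ Lℓ * frobNorm (X - X'))
    (hgwc : ConvexOn ℝ 𝒳 (fun X => g X + Lg / 2 * frobNorm X ^ 2))
    (h𝒴symm : ∀ Y ∈ 𝒴, Y.IsSymm) (h𝒴conv : Convex ℝ 𝒴) (h𝒴cpt : IsCompact 𝒴)
    (h𝒴zero : (0 : Matrix (Fin n) (Fin n) ℝ) ∈ 𝒴)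
    (h𝒴R : ∀ Y ∈ 𝒴, frobNorm Y ≤ RY)
    (hρ : 0 ≤ ρ) (hε : 0 < ε) (hlam : 0 < lam) (hα : 0 < α) (hβ0 : 0 < β) (hβ1 : β < 1)
    (hμρ : μρ = (Lℓ + Lg) + 2 * RY + 2 * ρ)
    (hLρ : Lρ = Lℓ + 2 * RY + 6 * ρ * RX ^ 2 + 2 * ρ)
    (hr : μρ < r) (hlamg : Lg < lam⁻¹)
    (hζ : ζ = (2 * (lam⁻¹ + Lρ) / (r - μρ) + 1) * (Real.sqrt (2 * Lρ / (lam⁻¹ + Lρ)) + 1))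
    (Xm : Matrix (Fin n) (Fin n) ℝ → Matrix (Fin m) (Fin n) ℝ → Matrix (Fin m) (Fin n) ℝ)
    (hXm : ∀ Y Z, Xm Y Z ∈ 𝒳 ∧ ∀ X' ∈ 𝒳, Ffun ℓ g ρ r ε (Xm Y Z) Y Z ≤ Ffun ℓ g ρ r ε X' Y Z)
    (proj : Matrix (Fin n) (Fin n) ℝ → Matrix (Fin n) (Fin n) ℝ)
    (hproj : ∀ W, proj W ∈ 𝒴 ∧ ∀ Y' ∈ 𝒴, frobNorm (W - proj W) ≤ frobNorm (W - Y'))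
    (XS ZS : ℕ → Matrix (Fin m) (Fin n) ℝ) (YS : ℕ → Matrix (Fin n) (Fin n) ℝ)
    (hX0 : XS 0 ∈ 𝒳) (hX0feas : (XS 0)ᵀ * XS 0 = 1) (hY0 : YS 0 = 0) (hZ0 : ZS 0 = XS 0)
    (hXit : ∀ k : ℕ, XS (k + 1) ∈ 𝒳 ∧ ∀ X' ∈ 𝒳,
      LinLag ℓ g gradl ρ lam (XS k) (XS (k + 1)) (YS k)
          + r / 2 * frobNorm (XS (k + 1) - ZS k) ^ 2
        ≤ LinLag ℓ g gradl ρ lam (XS k) X' (YS k) + r / 2 * frobNorm (X' - ZS k) ^ 2)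
    (hZit : ∀ k : ℕ, ZS (k + 1) = ZS k + β • (XS (k + 1) - ZS k))
    (hYit : ∀ k : ℕ, YS (k + 1) = proj (YS k + α • (Gm (XS (k + 1)) - ε • YS k))) :
    ∀ k : ℕ, frobNorm (XS (k + 1) - Xm (YS k) (ZS k)) ≤ ζ * frobNorm (XS k - XS (k + 1)) := by
  intro k
  have hXmem : ∀ k, XS k ∈ 𝒳
    | 0 => hX0
    | k + 1 => (hXit k).1
  have hYmem : ∀ k, YS k ∈ 𝒴
    | 0 => hY0 ▸ h𝒴zero
    | k + 1 => hYit k ▸ (hproj _).1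
  have hY := hYmem k
  have hkey := linearized_step_error h𝒳R hgrad hgradLip hgwc hρ hlam (h𝒴symm _ hY)
    (h𝒴R _ hY) (hXmem k) (hXit k).1 (hXm (YS k) (ZS k)).1 (hXm (YS k) (ZS k)).2 (hXit k).2
  have hlipk := hgradLip _ (hXmem k) _ (hXit k).1
  have hgrad0 := frobNorm_nonneg (gradl (XS k) - gradl (XS (k + 1)))
  have hRY : 0 ≤ RY := (frobNorm_nonneg _).trans (h𝒴R _ hY)
  rw [← hμρ, ← hLρ] at hkey
  have hd0 := frobNorm_nonneg (XS (k + 1) - Xm (YS k) (ZS k))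
  have he0 := frobNorm_nonneg (XS k - XS (k + 1))
  generalize frobNorm (XS (k + 1) - Xm (YS k) (ZS k)) = d at *
  generalize frobNorm (XS k - XS (k + 1)) = e at *
  have hrμ : 0 < r - μρ := sub_pos.mpr hr
  rcases he0.eq_or_lt with he1 | he1
  · rw [← he1] at hkey ⊢
    have hd2 : d ^ 2 ≤ 0 := by
      by_contra! hpos
      nlinarith [mul_pos hrμ hpos]
    rw [mul_zero]
    exact (pow_eq_zero_iff two_ne_zero).mp (le_antisymm hd2 (sq_nonneg d)) |>.le
  have hLℓ : 0 ≤ Lℓ := nonneg_of_mul_nonneg_left (hgrad0.trans hlipk) he1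
  have hLρ0 : 0 ≤ Lρ := by rw [hLρ]; positivity
  have hc : 0 ≤ (lam⁻¹ + Lρ) / (r - μρ) := by positivity
  have hbound : d ≤ (lam⁻¹ + Lρ) / (r - μρ) * e := by
    rw [div_mul_eq_mul_div, le_div_iff₀ hrμ]
    rcases hd0.eq_or_lt with hd1 | hd1
    · rw [← hd1, zero_mul]; positivity
    · nlinarith
  refine hbound.trans (mul_le_mul_of_nonneg_right ?_ he0)
  rw [hζ, mul_div_assoc]
  nlinarith [Real.sqrt_nonneg (2 * Lρ / (lam⁻¹ + Lρ)),
    mul_nonneg hc (Real.sqrt_nonneg (2 * Lρ / (lam⁻¹ + Lρ)))]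

end
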